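/- arXiv:1801.07525 — 3 statements merged into one kernel-verified Lean document; each statement's English description precedes it below -/
import Mathlib

section
/- Let I be a real interval, f : I → ℝ a C² function with nowhere vanishing first derivative, n ∈ ℕ, and a ∈ Iⁿ. Then there exists η ∈ [min(a), max(a)] such that R_f(a) = (Var(a)/2)·(f″(η) − f″(ā))/f′(ā). -/
/-- Arithmetic mean of a finite vector of reals. -/
noncomputable def amean {n : ℕ} (a : Fin n → ℝ) : ℝ := (∑ i, a i) / n

/-- Variance of a finite vector of reals. -/
noncomputable def varV {n : ℕ} (a : Fin n → ℝ) : ℝ := (∑ i, (a i - amean a) ^ 2) / n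

/-- Spread (max - min) of a finite vector of reals. -/
noncomputable def deltaV {n : ℕ} (a : Fin n → ℝ) : ℝ := sSup (Set.range a) - sInf (Set.range a)

/-- The remainder term `R_f(a)` (Taylor remainder form). -/
noncomputable def Rf (f f' f'' : ℝ → ℝ) {n : ℕ} (a : Fin n → ℝ) : ℝ :=
  (1 / (n * f' (amean a))) *
    ∑ i, (f (a i) - f (amean a) - f' (amean a) * (a i - amean a)
          - (1 / 2) * f'' (amean a) * (a i - amean a) ^ 2)

/-- The remainder term `S_f`, where `m` is the arithmetic mean of the vector and
`Q` is the quasi-arithmetic mean `QA_f(a)`. -/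
noncomputable def Sf (f f' f'' : ℝ → ℝ) (m Q : ℝ) : ℝ :=
  ∫ u in m..Q, (f u - f Q) * f'' u / (f' u) ^ 2

/-- The star norm `‖g‖_* = sup_{p,q ∈ I} |∫_p^q g|`. -/
noncomputable def starNorm (g : ℝ → ℝ) (I : Set ℝ) : ℝ :=
  sSup {x | ∃ p ∈ I, ∃ q ∈ I, x = |∫ t in p..q, g t|}

/-- Second-order Taylor formula with Lagrange remainder, for a function that is twice
differentiable on an order-connected set. -/
theorem exists_taylor_two_lagrange {I : Set ℝ} (hI : I.OrdConnected) {f f' f'' : ℝ → ℝ}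
    (hd1 : ∀ x ∈ I, HasDerivAt f (f' x) x) (hd2 : ∀ x ∈ I, HasDerivAt f' (f'' x) x)
    {c x : ℝ} (hc : c ∈ I) (hx : x ∈ I) :
    ∃ ξ ∈ Set.uIcc c x, f x - f c - f' c * (x - c) = f'' ξ * (x - c) ^ 2 / 2 := by
  have hsub : Set.uIcc c x ⊆ I := hI.uIcc_subset hc hx
  have hF : ∀ t ∈ Set.uIcc c x,
      HasDerivAt (fun t => f t + f' t * (x - t)) (f'' t * (x - t)) t := fun t ht => by
    refine ((hd1 t (hsub ht)).add
      ((hd2 t (hsub ht)).mul ((hasDerivAt_id' t).const_sub x))).congr_deriv ?_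
    ring
  have hG : ∀ t, HasDerivAt (fun t => (x - t) ^ 2) (-2 * (x - t)) t := fun t => by
    refine (((hasDerivAt_id' t).const_sub x).pow 2).congr_deriv ?_
    push_cast
    ring
  have hFc : ContinuousOn (fun t => f t + f' t * (x - t)) (Set.uIcc c x) :=
    fun t ht => (hF t ht).continuousAt.continuousWithinAt
  have hGc : Continuous fun t : ℝ => (x - t) ^ 2 := by fun_prop
  rcases lt_trichotomy c x with h | rfl | h
  · rw [Set.uIcc_of_le h.le] at hF hFc ⊢
    obtain ⟨ξ, hξ, e⟩ := exists_ratio_hasDerivAt_eq_ratio_slope _ _ h hFc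
      (fun t ht => hF t (Set.Ioo_subset_Icc_self ht)) _ _ hGc.continuousOn (fun t _ => hG t)
    refine ⟨ξ, Set.Ioo_subset_Icc_self hξ, ?_⟩
    have hne : x - ξ ≠ 0 := sub_ne_zero.2 hξ.2.ne'
    apply mul_right_cancel₀ hne
    linear_combination e / 2
  · exact ⟨c, Set.left_mem_uIcc, by ring⟩
  · rw [Set.uIcc_of_ge h.le] at hF hFc ⊢
    obtain ⟨ξ, hξ, e⟩ := exists_ratio_hasDerivAt_eq_ratio_slope _ _ h hFc
      (fun t ht => hF t (Set.Ioo_subset_Icc_self ht)) _ _ hGc.continuousOn (fun t _ => hG t)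
    refine ⟨ξ, Set.Ioo_subset_Icc_self hξ, ?_⟩
    have hne : x - ξ ≠ 0 := sub_ne_zero.2 hξ.1.ne
    apply mul_right_cancel₀ hne
    linear_combination -e / 2

/-- Weighted mean value property of a continuous function on an order-connected set. -/
theorem exists_sum_mul_eq_mul_sum {ι : Type*} {s : Finset ι} {K : Set ℝ} (hK : K.OrdConnected)
    (hne : K.Nonempty) {g : ℝ → ℝ} (hg : ContinuousOn g K) {w ξ : ι → ℝ}
    (hw : ∀ i ∈ s, 0 ≤ w i) (hξ : ∀ i ∈ s, ξ i ∈ K) :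
    ∃ η ∈ K, ∑ i ∈ s, g (ξ i) * w i = g η * ∑ i ∈ s, w i := by
  rcases (Finset.sum_nonneg hw).eq_or_lt with h | h
  · obtain ⟨η, hη⟩ := hne
    refine ⟨η, hη, ?_⟩
    rw [← h, mul_zero]
    refine Finset.sum_eq_zero fun i hi => ?_
    rw [(Finset.sum_eq_zero_iff_of_nonneg hw).1 h.symm i hi, mul_zero]
  · have hconv : Convex ℝ (g '' K) :=
      (hK.isPreconnected.image g hg).ordConnected.convex
    obtain ⟨η, hη, e⟩ := hconv.centerMass_mem hw h
      (z := fun i => g (ξ i)) (fun i hi => Set.mem_image_of_mem g (hξ i hi))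
    refine ⟨η, hη, ?_⟩
    rw [e, Finset.centerMass]
    simp only [smul_eq_mul]
    rw [inv_mul_eq_div, div_mul_cancel₀ _ h.ne']
    exact Finset.sum_congr rfl fun i _ => mul_comm _ _

/-- The mean lies between any lower and upper bound of the entries. -/
theorem amean_mem_Icc {n : ℕ} (hn : 0 < n) {a : Fin n → ℝ} {l u : ℝ}
    (h : ∀ i, a i ∈ Set.Icc l u) : amean a ∈ Set.Icc l u := by
  have hn' : (0 : ℝ) < n := Nat.cast_pos.2 hn
  rw [amean, Set.mem_Icc, le_div_iff₀ hn', div_le_iff₀ hn']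
  constructor
  · simpa [mul_comm] using Finset.card_nsmul_le_sum Finset.univ a l fun i _ => (h i).1
  · simpa [mul_comm] using Finset.sum_le_card_nsmul Finset.univ a u fun i _ => (h i).2

theorem Rf_mean_value_form
    (I : Set ℝ) (hI : I.OrdConnected)
    (f f' f'' : ℝ → ℝ)
    (hd1 : ∀ x ∈ I, HasDerivAt f (f' x) x)
    (hd2 : ∀ x ∈ I, HasDerivAt f' (f'' x) x)
    (hc : ContinuousOn f'' I)
    (hne : ∀ x ∈ I, f' x ≠ 0)
    (n : ℕ) (hn : 0 < n) (a : Fin n → ℝ) (ha : ∀ i, a i ∈ I) :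
    ∃ η ∈ Set.Icc (sInf (Set.range a)) (sSup (Set.range a)),
      Rf f f' f'' a = varV a / 2 * ((f'' η - f'' (amean a)) / f' (amean a)) := by
  have : Nonempty (Fin n) := ⟨⟨0, hn⟩⟩
  have hfin : (Set.range a).Finite := Set.finite_range a
  have hrange : Set.range a ⊆ I := Set.range_subset_iff.2 ha
  have haK : ∀ i, a i ∈ Set.Icc (sInf (Set.range a)) (sSup (Set.range a)) := fun i =>
    ⟨csInf_le hfin.bddBelow ⟨i, rfl⟩, le_csSup hfin.bddAbove ⟨i, rfl⟩⟩
  have hKI : Set.Icc (sInf (Set.range a)) (sSup (Set.range a)) ⊆ I :=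
    hI.out (hrange ((Set.range_nonempty a).csInf_mem hfin))
      (hrange ((Set.range_nonempty a).csSup_mem hfin))
  have hm := amean_mem_Icc hn haK
  choose ξ hξ e using fun i => exists_taylor_two_lagrange hI hd1 hd2 (hKI hm) (ha i)
  obtain ⟨η, hη, hsum⟩ := exists_sum_mul_eq_mul_sum (s := Finset.univ) Set.ordConnected_Icc
    ⟨_, hm⟩ (hc.mono hKI) (w := fun i => (a i - amean a) ^ 2) (fun i _ => sq_nonneg _)
    (fun i _ => Set.ordConnected_Icc.uIcc_subset hm (haK i) (hξ i))
  refine ⟨η, hη, ?_⟩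
  have key : ∑ i, (f (a i) - f (amean a) - f' (amean a) * (a i - amean a)
      - (1 / 2) * f'' (amean a) * (a i - amean a) ^ 2)
      = (f'' η - f'' (amean a)) / 2 * ∑ i, (a i - amean a) ^ 2 := by
    simp only [e]
    rw [Finset.sum_sub_distrib, ← Finset.sum_div, hsum, ← Finset.mul_sum]
    ring
  have hn' : (n : ℝ) ≠ 0 := Nat.cast_ne_zero.2 hn.ne'
  have hf' := hne _ (hKI hm)
  rw [Rf, key, varV]
  field_simp
end

section
/- Let I be a real interval, f : I → ℝ a C² function with nowhere vanishing first derivative, n ∈ ℕ, and a ∈ Iⁿ. Then QA_f(a) = ā + (1/2)·Var(a)·(f″(ā)/f′(ā)) + R_f(a) + S_f(a). Equivalently, QA_f(a) − ā − (f(QA_f(a)) − f(ā))/f′(ā) = ∫_{ā}^{QA_f(a)} (f(u) − f(QA_f(a)))·f″(u)/f′(u)² du. -/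
theorem amean_mem {I : Set ℝ} (hI : I.OrdConnected) {n : ℕ} (hn : 0 < n) {a : Fin n → ℝ}
    (ha : ∀ i, a i ∈ I) : amean a ∈ I := by
  have hn' : (n : ℝ) ≠ 0 := by positivity
  have h := hI.convex.sum_mem (t := Finset.univ) (w := fun _ : Fin n => (n : ℝ)⁻¹) (z := a)
    (fun _ _ => by positivity) (by simp [hn']) (fun i _ => ha i)
  simpa [amean, ← Finset.mul_sum, div_eq_inv_mul] using h

/-- The integrand of `Sf` is the derivative of the Newton map `u ↦ u - (f u - f Q) / f' u`. -/
theorem sf_eq_sub {I : Set ℝ} (hI : I.OrdConnected) {f f' f'' : ℝ → ℝ}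
    (hd1 : ∀ x ∈ I, HasDerivAt f (f' x) x) (hd2 : ∀ x ∈ I, HasDerivAt f' (f'' x) x)
    (hc : ContinuousOn f'' I) (hne : ∀ x ∈ I, f' x ≠ 0) {m Q : ℝ} (hm : m ∈ I) (hQ : Q ∈ I) :
    Sf f f' f'' m Q = Q - m - (f Q - f m) / f' m := by
  have hsub : Set.uIcc m Q ⊆ I := hI.uIcc_subset hm hQ
  have hderiv : ∀ x ∈ Set.uIcc m Q, HasDerivAt (fun u => u - (f u - f Q) / f' u)
      ((f x - f Q) * f'' x / f' x ^ 2) x := fun x hx => by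
    have hx0 := hne x (hsub hx)
    refine ((hasDerivAt_id x).sub
      (((hd1 x (hsub hx)).sub_const (f Q)).div (hd2 x (hsub hx)) hx0)).congr_deriv ?_
    field_simp
    ring
  have hf : ContinuousOn f I := fun x hx => (hd1 x hx).continuousAt.continuousWithinAt
  have hf' : ContinuousOn f' I := fun x hx => (hd2 x hx).continuousAt.continuousWithinAt
  have hint : ContinuousOn (fun u => (f u - f Q) * f'' u / f' u ^ 2) I :=
    ((hf.sub continuousOn_const).mul hc).div (hf'.pow 2) fun x hx => pow_ne_zero 2 (hne x hx)
  rw [Sf, intervalIntegral.integral_eq_sub_of_hasDerivAt hderiv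
    (hint.mono hsub).intervalIntegrable]
  ring

/-- The first-order terms of the Taylor remainders cancel on averaging. -/
theorem half_varV_mul_add_Rf {n : ℕ} (hn : 0 < n) {f f' : ℝ → ℝ} (f'' : ℝ → ℝ) (a : Fin n → ℝ)
    (h0 : f' (amean a) ≠ 0) :
    1 / 2 * varV a * (f'' (amean a) / f' (amean a)) + Rf f f' f'' a
      = ((∑ i, f (a i)) / n - f (amean a)) / f' (amean a) := by
  have hn' : (n : ℝ) ≠ 0 := by positivity
  have hsum : ∑ i, (a i - amean a) = 0 := by
    simp only [Finset.sum_sub_distrib, Finset.sum_const, Finset.card_univ, Fintype.card_fin,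
      nsmul_eq_mul, amean]
    field_simp
    ring
  have hR : Rf f f' f'' a = 1 / (n * f' (amean a)) * (∑ i, f (a i) - n * f (amean a)
      - 1 / 2 * f'' (amean a) * ∑ i, (a i - amean a) ^ 2) := by
    rw [Rf, Finset.sum_sub_distrib, Finset.sum_sub_distrib, Finset.sum_sub_distrib,
      ← Finset.mul_sum, ← Finset.mul_sum, hsum]
    simp
  rw [hR, varV]
  field_simp
  ring

theorem quasiArithMean_expansion
    (I : Set ℝ) (hI : I.OrdConnected)
    (f f' f'' : ℝ → ℝ)
    (hd1 : ∀ x ∈ I, HasDerivAt f (f' x) x)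
    (hd2 : ∀ x ∈ I, HasDerivAt f' (f'' x) x)
    (hc : ContinuousOn f'' I)
    (hne : ∀ x ∈ I, f' x ≠ 0)
    (n : ℕ) (hn : 0 < n) (a : Fin n → ℝ) (ha : ∀ i, a i ∈ I)
    (Q : ℝ) (hQI : Q ∈ I) (hQ : f Q = (∑ i, f (a i)) / n) :
    Q = amean a + 1 / 2 * varV a * (f'' (amean a) / f' (amean a))
          + Rf f f' f'' a + Sf f f' f'' (amean a) Q
      ∧ Q - amean a - (f Q - f (amean a)) / f' (amean a)
          = Sf f f' f'' (amean a) Q := by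
  have hm := amean_mem hI hn ha
  have hS := sf_eq_sub hI hd1 hd2 hc hne hm hQI
  have hR := half_varV_mul_add_Rf (f := f) hn f'' a (hne _ hm)
  rw [← hQ] at hR
  exact ⟨by linarith, hS.symm⟩
end

section
/- Let I be a real interval, n ∈ ℕ, and let f₁,…,fₙ : I → ℝ be C² functions with nowhere vanishing first derivative such that each fₖ″ is Lipschitz on I with Lipschitz constant Lₖ and ‖fₖ″/fₖ′‖_∞ ≤ 1. Let a ∈ Iⁿ with δ(a) < 1, set α := (3+7e)/3 and C := (1/n)Σₖ (Lₖ/(2|fₖ′(ā)|) + α²e/4). Then for every j ∈ {1,…,n}, |QA_{fⱼ}(a) − (1/n)Σₖ QA_{fₖ}(a) − (1/2)·Var(a)·(fⱼ″(ā)/fⱼ′(ā) − (1/n)Σₖ fₖ″(ā)/fₖ′(ā))| ≤ (C + Lⱼ/(2|fⱼ′(ā)|) + α²e/4)·δ(a)³. -/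
open Set

theorem exists_mem_uIcc_image_sub_eq {F F' : ℝ → ℝ} {J : Set ℝ} (hJ : J.OrdConnected)
    (hF : ∀ x ∈ J, HasDerivAt F (F' x) x) {x y : ℝ} (hx : x ∈ J) (hy : y ∈ J) :
    ∃ ξ ∈ uIcc y x, F x - F y = F' ξ * (x - y) := by
  rcases lt_trichotomy x y with h | h | h
  · have hs : Icc x y ⊆ J := hJ.out hx hy
    obtain ⟨c, hc, he⟩ := exists_hasDerivAt_eq_slope F F' h
      (fun z hz => (hF z (hs hz)).continuousAt.continuousWithinAt)
      (fun z hz => hF z (hs (Ioo_subset_Icc_self hz)))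
    refine ⟨c, Icc_subset_uIcc' (Ioo_subset_Icc_self hc), ?_⟩
    rw [he]
    have : y - x ≠ 0 := sub_ne_zero.2 h.ne'
    field_simp
    ring
  · subst h
    exact ⟨x, left_mem_uIcc, by simp⟩
  · have hs : Icc y x ⊆ J := hJ.out hy hx
    obtain ⟨c, hc, he⟩ := exists_hasDerivAt_eq_slope F F' h
      (fun z hz => (hF z (hs hz)).continuousAt.continuousWithinAt)
      (fun z hz => hF z (hs (Ioo_subset_Icc_self hz)))
    refine ⟨c, Icc_subset_uIcc (Ioo_subset_Icc_self hc), ?_⟩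
    rw [he]
    have : x - y ≠ 0 := sub_ne_zero.2 h.ne'
    field_simp

/-- If `g` has logarithmic derivative bounded by one, then its values at points of distance at
most one differ by a factor of at most `e`. -/
theorem abs_le_exp_one_mul_abs {g g' : ℝ → ℝ} {J : Set ℝ} (hJ : J.OrdConnected)
    (hg : ∀ x ∈ J, HasDerivAt g (g' x) x) (hne : ∀ x ∈ J, g x ≠ 0)
    (hb : ∀ x ∈ J, |g' x / g x| ≤ 1) {x y : ℝ} (hx : x ∈ J) (hy : y ∈ J) (hxy : |x - y| ≤ 1) :
    |g x| ≤ Real.exp 1 * |g y| := by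
  obtain ⟨ξ, hξ, he⟩ := exists_mem_uIcc_image_sub_eq (F := fun x => Real.log (g x)) hJ
    (fun z hz => (hg z hz).log (hne z hz)) hx hy
  have h1 : Real.log (g x) - Real.log (g y) ≤ 1 := by
    refine (le_abs_self _).trans ?_
    rw [he, abs_mul]
    exact mul_le_one₀ (hb ξ (hJ.uIcc_subset hy hx hξ)) (abs_nonneg _) hxy
  have hx0 := abs_pos.2 (hne x hx)
  have hy0 := abs_pos.2 (hne y hy)
  rw [← Real.exp_log hx0, ← Real.exp_log hy0, ← Real.exp_add, Real.log_abs, Real.log_abs]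
  exact Real.exp_le_exp.2 (by linarith)

theorem amean_sub {n : ℕ} (a b : Fin n → ℝ) :
    amean (fun i => a i - b i) = amean a - amean b := by
  simp [amean, Finset.sum_sub_distrib, sub_div]

theorem amean_mul_left {n : ℕ} (c : ℝ) (a : Fin n → ℝ) :
    amean (fun i => c * a i) = c * amean a := by
  simp [amean, ← Finset.mul_sum, mul_div_assoc]

theorem amean_const {n : ℕ} (hn : 0 < n) (c : ℝ) : amean (fun _ : Fin n => c) = c := by
  have : (n : ℝ) ≠ 0 := by positivity
  simp [amean, this]

theorem amean_mono {n : ℕ} {a b : Fin n → ℝ} (h : ∀ i, a i ≤ b i) : amean a ≤ amean b := by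
  unfold amean
  gcongr with i
  exact h i

theorem abs_amean_le {n : ℕ} {a b : Fin n → ℝ} (h : ∀ i, |a i| ≤ b i) :
    |amean a| ≤ amean b := by
  refine le_trans ?_ (amean_mono h)
  unfold amean
  rw [abs_div, Nat.abs_cast]
  gcongr
  exact Finset.abs_sum_le_sum_abs _ _

theorem amean_mem_of_ordConnected {n : ℕ} (hn : 0 < n) {J : Set ℝ} (hJ : J.OrdConnected)
    {a : Fin n → ℝ} (ha : ∀ i, a i ∈ J) : amean a ∈ J := by
  have : Nonempty (Fin n) := ⟨⟨0, hn⟩⟩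
  obtain ⟨p, hp⟩ := Finite.exists_min a
  obtain ⟨q, hq⟩ := Finite.exists_max a
  refine hJ.out (ha p) (ha q) ⟨?_, ?_⟩
  · rw [← amean_const hn (a p)]; exact amean_mono hp
  · rw [← amean_const hn (a q)]; exact amean_mono hq

theorem varV_eq_amean {n : ℕ} (a : Fin n → ℝ) :
    varV a = amean (fun i => (a i - amean a) ^ 2) := rfl

theorem varV_nonneg {n : ℕ} (a : Fin n → ℝ) : 0 ≤ varV a := by
  unfold varV; positivity

/-- Popoviciu's inequality on variances. -/
theorem varV_le_sq_div_four {n : ℕ} (hn : 0 < n) {a : Fin n → ℝ} {lo hi : ℝ}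
    (ha : ∀ i, a i ∈ Icc lo hi) : varV a ≤ (hi - lo) ^ 2 / 4 := by
  set m := amean a with hm
  have h1 : varV a ≤ amean (fun i => (lo + hi - 2 * m) * (a i - m) - (lo - m) * (hi - m)) := by
    rw [varV_eq_amean]
    refine amean_mono fun i => ?_
    nlinarith [mul_nonneg (sub_nonneg.2 (ha i).1) (sub_nonneg.2 (ha i).2)]
  rw [amean_sub, amean_mul_left, amean_sub, amean_const hn, amean_const hn, ← hm] at h1
  nlinarith [sq_nonneg (lo + hi - 2 * m)]

theorem abs_quasiArithMean_sub_le (n : ℕ) (hn : 0 < n) {lo hi : ℝ} (hD : hi - lo ≤ 1)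
    {f f' f'' : ℝ → ℝ} {L : ℝ} (hL : 0 ≤ L)
    (hd1 : ∀ x ∈ Icc lo hi, HasDerivAt f (f' x) x)
    (hd2 : ∀ x ∈ Icc lo hi, HasDerivAt f' (f'' x) x)
    (hne : ∀ x ∈ Icc lo hi, f' x ≠ 0)
    (hLip : ∀ x ∈ Icc lo hi, ∀ y ∈ Icc lo hi, |f'' x - f'' y| ≤ L * |x - y|)
    (hAP : ∀ x ∈ Icc lo hi, |f'' x / f' x| ≤ 1)
    {a : Fin n → ℝ} (ha : ∀ i, a i ∈ Icc lo hi) {Q : ℝ} (hQI : Q ∈ Icc lo hi)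
    (hQ : f Q = amean (fun i => f (a i))) :
    |Q - amean a - 1 / 2 * varV a * (f'' (amean a) / f' (amean a))|
      ≤ (L / (2 * |f' (amean a)|) + ((3 + 7 * Real.exp 1) / 3) ^ 2 * Real.exp 1 / 4)
        * (hi - lo) ^ 3 := by
  have hJ : (Icc lo hi).OrdConnected := ordConnected_Icc
  set m := amean a with hm
  have hmI : m ∈ Icc lo hi := amean_mem_of_ordConnected hn hJ ha
  set D := hi - lo with hDdef
  have hD0 : 0 ≤ D := by linarith [hmI.1, hmI.2]
  have hdist : ∀ x ∈ Icc lo hi, |x - m| ≤ D := fun x hx =>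
    abs_le.2 ⟨by linarith [hx.1, hx.2, hmI.1, hmI.2], by linarith [hx.1, hx.2, hmI.1, hmI.2]⟩
  set d := f' m with hd
  have hd0 : 0 < |d| := abs_pos.2 (hne m hmI)
  set e := Real.exp 1 with he
  have he0 : 0 < e := Real.exp_pos 1
  have hup : ∀ x ∈ Icc lo hi, |f' x| ≤ e * |d| := fun x hx =>
    abs_le_exp_one_mul_abs hJ hd2 hne hAP hx hmI ((hdist x hx).trans hD)
  have hlow : ∀ x ∈ Icc lo hi, |d| ≤ e * |f' x| := fun x hx =>
    abs_le_exp_one_mul_abs hJ hd2 hne hAP hmI hx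
      (by rw [abs_sub_comm]; exact (hdist x hx).trans hD)
  have hf2 : ∀ x ∈ Icc lo hi, |f'' x| ≤ e * |d| := fun x hx => by
    have := hAP x hx
    rw [abs_div, div_le_one (abs_pos.2 (hne x hx))] at this
    exact this.trans (hup x hx)
  have hT2 : ∀ x ∈ Icc lo hi, |f x - f m - d * (x - m)| ≤ e * |d| * (x - m) ^ 2 := by
    intro x hx
    obtain ⟨ξ, hξ, h1⟩ := exists_mem_uIcc_image_sub_eq hJ hd1 hx hmI
    have hξI := hJ.uIcc_subset hmI hx hξ
    obtain ⟨ζ, hζ, h2⟩ := exists_mem_uIcc_image_sub_eq hJ hd2 hξI hmI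
    have hζI := hJ.uIcc_subset hmI hξI hζ
    have h3 : f x - f m - d * (x - m) = f'' ζ * (ξ - m) * (x - m) := by
      rw [h1, ← h2]; ring
    rw [h3, abs_mul, abs_mul, ← sq_abs (x - m), pow_two, ← mul_assoc]
    exact mul_le_mul_of_nonneg_right (mul_le_mul (hf2 ζ hζI) (abs_sub_left_of_mem_uIcc hξ)
      (abs_nonneg _) (by positivity)) (abs_nonneg _)
  have hT3 : ∀ x ∈ Icc lo hi,
      |f x - f m - d * (x - m) - 1 / 2 * f'' m * (x - m) ^ 2| ≤ L * D * (x - m) ^ 2 := by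
    intro x hx
    obtain ⟨ξ, hξ, h1⟩ := exists_mem_uIcc_image_sub_eq
      (F := fun x => f x - d * (x - m) - 1 / 2 * f'' m * (x - m) ^ 2)
      (F' := fun x => f' x - d - f'' m * (x - m)) hJ
      (fun z hz => by
        refine (((hd1 z hz).sub (((hasDerivAt_id z).sub_const m).const_mul d)).sub
          ((((hasDerivAt_id z).sub_const m).pow 2).const_mul (1 / 2 * f'' m))).congr_deriv ?_
        simp only [id, Nat.cast_ofNat]
        ring) hx hmI
    have hξI := hJ.uIcc_subset hmI hx hξ
    obtain ⟨ζ, hζ, h2⟩ := exists_mem_uIcc_image_sub_eq hJ hd2 hξI hmI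
    have hζI := hJ.uIcc_subset hmI hξI hζ
    have h3 : f x - f m - d * (x - m) - 1 / 2 * f'' m * (x - m) ^ 2
        = (f'' ζ - f'' m) * (ξ - m) * (x - m) := by
      have : (f'' ζ - f'' m) * (ξ - m) = f' ξ - d - f'' m * (ξ - m) := by
        rw [hd, h2]; ring
      rw [this, ← h1]; ring
    rw [h3, abs_mul, abs_mul, ← sq_abs (x - m), pow_two, ← mul_assoc]
    have h4 : |f'' ζ - f'' m| ≤ L * D :=
      (hLip ζ hζI m hmI).trans (mul_le_mul_of_nonneg_left (hdist ζ hζI) hL)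
    exact mul_le_mul_of_nonneg_right (mul_le_mul h4 (abs_sub_left_of_mem_uIcc hξ)
      (abs_nonneg _) (by positivity)) (abs_nonneg _)
  have hV4 : varV a ≤ D ^ 2 / 4 := varV_le_sq_div_four hn ha
  have hV0 := varV_nonneg a
  have hmean : amean (fun i => f (a i) - f m - d * (a i - m)) = f Q - f m := by
    rw [amean_sub, amean_sub, amean_mul_left, amean_sub, amean_const hn, amean_const hn, ← hQ,
      ← hm]
    ring
  have hS2 : |f Q - f m| ≤ e * |d| * varV a := by
    rw [← hmean, varV_eq_amean, ← amean_mul_left]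
    exact abs_amean_le fun i => hT2 _ (ha i)
  have hS3 : |f Q - f m - 1 / 2 * f'' m * varV a| ≤ L * D * varV a := by
    rw [← hmean, varV_eq_amean, ← amean_mul_left, ← amean_mul_left, ← amean_sub]
    exact abs_amean_le fun i => hT3 _ (ha i)
  have hQm : |Q - m| ≤ e ^ 2 / 4 * D ^ 2 := by
    obtain ⟨ξ, hξ, h1⟩ := exists_mem_uIcc_image_sub_eq hJ hd1 hQI hmI
    have hξI := hJ.uIcc_subset hmI hQI hξ
    rw [h1, abs_mul] at hS2
    have h2 : |d| * |Q - m| ≤ |d| * (e ^ 2 / 4 * D ^ 2) :=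
      calc |d| * |Q - m| ≤ e * |f' ξ| * |Q - m| := by gcongr; exact hlow ξ hξI
        _ = e * (|f' ξ| * |Q - m|) := by ring
        _ ≤ e * (e * |d| * (D ^ 2 / 4)) := by
          exact mul_le_mul_of_nonneg_left
            (hS2.trans (mul_le_mul_of_nonneg_left hV4 (by positivity))) he0.le
        _ = |d| * (e ^ 2 / 4 * D ^ 2) := by ring
    exact le_of_mul_le_mul_left h2 hd0
  have hsq : (Q - m) ^ 2 ≤ ((3 + 7 * e) / 3) ^ 2 / 4 * D ^ 3 := by
    have he3 : e ≤ 3 := by rw [he]; linarith [Real.exp_one_lt_d9]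
    have hc : (e ^ 2 / 4) ^ 2 ≤ ((3 + 7 * e) / 3) ^ 2 / 4 := by
      have : e ^ 2 / 4 ≤ (3 + 7 * e) / 3 / 2 := by nlinarith
      calc (e ^ 2 / 4) ^ 2 ≤ ((3 + 7 * e) / 3 / 2) ^ 2 := by gcongr
        _ = _ := by ring
    calc (Q - m) ^ 2 = |Q - m| ^ 2 := (sq_abs _).symm
      _ ≤ (e ^ 2 / 4 * D ^ 2) ^ 2 := by gcongr
      _ = (e ^ 2 / 4) ^ 2 * D ^ 4 := by ring
      _ ≤ (((3 + 7 * e) / 3) ^ 2 / 4) * D ^ 3 :=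
        mul_le_mul hc (pow_le_pow_of_le_one hD0 hD (by norm_num)) (by positivity) (by positivity)
  have hdne : d ≠ 0 := abs_pos.1 hd0
  have hkey : Q - m - 1 / 2 * varV a * (f'' m / d)
      = ((f Q - f m - 1 / 2 * f'' m * varV a) - (f Q - f m - d * (Q - m))) / d := by
    field_simp
    ring
  rw [hkey, abs_div, div_le_iff₀ hd0]
  calc |(f Q - f m - 1 / 2 * f'' m * varV a) - (f Q - f m - d * (Q - m))|
      ≤ |f Q - f m - 1 / 2 * f'' m * varV a| + |f Q - f m - d * (Q - m)| := abs_sub _ _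
    _ ≤ L * D * (D ^ 2 / 2) + e * |d| * (((3 + 7 * e) / 3) ^ 2 / 4 * D ^ 3) := by
        refine add_le_add (hS3.trans ?_) ((hT2 Q hQI).trans ?_)
        · gcongr
          linarith [sq_nonneg D]
        · gcongr
    _ = (L / (2 * |d|) + ((3 + 7 * e) / 3) ^ 2 * e / 4) * D ^ 3 * |d| := by
        field_simp

theorem quasiArithMean_deviation_expansion
    (I : Set ℝ) (hI : I.OrdConnected) (n : ℕ) (hn : 0 < n)
    (f f' f'' : Fin n → ℝ → ℝ) (L : Fin n → ℝ) (hL : ∀ k, 0 ≤ L k)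
    (hd1 : ∀ k, ∀ x ∈ I, HasDerivAt (f k) (f' k x) x)
    (hd2 : ∀ k, ∀ x ∈ I, HasDerivAt (f' k) (f'' k x) x)
    (hc : ∀ k, ContinuousOn (f'' k) I)
    (hne : ∀ k, ∀ x ∈ I, f' k x ≠ 0)
    (hLip : ∀ k, ∀ x ∈ I, ∀ y ∈ I, |f'' k x - f'' k y| ≤ L k * |x - y|)
    (hAP : ∀ k, ∀ x ∈ I, |f'' k x / f' k x| ≤ 1)
    (a : Fin n → ℝ) (ha : ∀ i, a i ∈ I) (hδ : deltaV a < 1)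
    -- Q k is the quasi-arithmetic mean QA_{f_k}(a):
    (Q : Fin n → ℝ) (hQI : ∀ k, Q k ∈ I)
    (hQ : ∀ k, f k (Q k) = (∑ i, f k (a i)) / n)
    (j : Fin n) :
    |Q j - amean Q
        - 1 / 2 * varV a * (f'' j (amean a) / f' j (amean a)
            - amean (fun k => f'' k (amean a) / f' k (amean a)))|
      ≤ (amean (fun k => L k / (2 * |f' k (amean a)|)
            + ((3 + 7 * Real.exp 1) / 3) ^ 2 * Real.exp 1 / 4)
          + L j / (2 * |f' j (amean a)|)
          + ((3 + 7 * Real.exp 1) / 3) ^ 2 * Real.exp 1 / 4) * deltaV a ^ 3 := by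
  have : Nonempty (Fin n) := ⟨⟨0, hn⟩⟩
  have hfin := finite_range a
  set lo := sInf (range a) with hlo
  set hi := sSup (range a) with hhi
  have hloI : lo ∈ I := by
    obtain ⟨i, hi⟩ := (range_nonempty a).csInf_mem hfin
    rw [hlo, ← hi]; exact ha i
  have hhiI : hi ∈ I := by
    obtain ⟨i, hi⟩ := (range_nonempty a).csSup_mem hfin
    rw [hhi, ← hi]; exact ha i
  have haJ : ∀ i, a i ∈ Icc lo hi := fun i =>
    ⟨csInf_le hfin.bddBelow (mem_range_self i), le_csSup hfin.bddAbove (mem_range_self i)⟩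
  have hJI : Icc lo hi ⊆ I := hI.out hloI hhiI
  have hQJ : ∀ k, Q k ∈ Icc lo hi := by
    intro k
    have himg : (f k '' Icc lo hi).OrdConnected :=
      (isPreconnected_Icc.image _ fun x hx =>
        (hd1 k x (hJI hx)).continuousAt.continuousWithinAt).ordConnected
    obtain ⟨q, hq, hfq⟩ := amean_mem_of_ordConnected hn himg
      (a := fun i => f k (a i)) (fun i => mem_image_of_mem _ (haJ i))
    obtain ⟨ξ, hξ, h⟩ := exists_mem_uIcc_image_sub_eq hI (hd1 k) (hQI k) (hJI hq)
    have h0 : f k (Q k) - f k q = 0 := by rw [hfq, hQ k]; exact sub_self _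
    rw [h0] at h
    have hQq := (mul_eq_zero.1 h.symm).resolve_left
      (hne k ξ (hI.uIcc_subset (hJI hq) (hQI k) hξ))
    rwa [sub_eq_zero.1 hQq]
  have hmain := fun k => abs_quasiArithMean_sub_le n hn (lo := lo) (hi := hi) (le_of_lt hδ) (hL k)
    (fun x hx => hd1 k x (hJI hx)) (fun x hx => hd2 k x (hJI hx)) (fun x hx => hne k x (hJI hx))
    (fun x hx y hy => hLip k x (hJI hx) y (hJI hy)) (fun x hx => hAP k x (hJI hx)) haJ (hQJ k)
    (hQ k)
  have hmean := abs_amean_le hmain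
  rw [amean_sub, amean_sub, amean_mul_left, amean_const hn] at hmean
  simp only [mul_comm _ ((hi - lo) ^ 3)] at hmean
  rw [amean_mul_left] at hmean
  have hj := hmain j
  have hδ3 : deltaV a = hi - lo := rfl
  rw [hδ3]
  rw [abs_le] at hmean hj ⊢
  constructor <;> linarith [hmean.1, hmean.2, hj.1, hj.2]
end
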